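/- Fix real parameters a > 0 and b ∈ (0,1), and let E : ℝ → ℝ be given by E(s) = exp(−1/s) for s > 0 and E(s) = 0 for s ≤ 0. Consider the vector field K on ℝ³ (coordinates (r̂₁, σ, ŝ₁)) given by r̂₁' = −2r̂₁²·(a + σ·r̂₁·ŝ₁²·E(σ)²), σ' = σ²·(1 + b·r̂₁·ŝ₁·(1 − 2E(σ))), ŝ₁' = −ŝ₁·( −r̂₁·(a + σ·r̂₁·ŝ₁²·E(σ)²) + (1 + σ)·(1 + b·r̂₁·ŝ₁·(1 − 2E(σ))) ). Then: (i) the origin p_s = (0,0,0) is an equilibrium of K and the derivative of K at p_s has eigenvalues 0, 0, −1; (ii) the three coordinate axes are invariant, with dynamics r̂₁' = −2a·r̂₁² on the r̂₁-axis, σ' = σ² on the σ-axis, and ŝ₁' = −ŝ₁ on the ŝ₁-axis; in particular r̂₁ is decreasing along the positive r̂₁-axis, σ is increasing along the positive σ-axis, and ŝ₁ is decreasing along the positive ŝ₁-axis, so p_s is a non-hyperbolic saddle whose strong stable manifold lies in {r̂₁ = σ = 0}. -/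

import Mathlib

/-- The exponential `exp(−1/s)` extended by `0` to `s ≤ 0`. -/
noncomputable def expE (s : ℝ) : ℝ := if 0 < s then Real.exp (-1 / s) else 0

/-- The desingularized system in chart `K̂₃₁` of the weighted cylindrical blow-up of the
non-hyperbolic line `L̃_{e,2}` in the Le Corbeiller analysis; coordinates `(r̂₁, σ, ŝ₁)`. -/
noncomputable def corbHatK31Field (a b : ℝ) (p : ℝ × ℝ × ℝ) : ℝ × ℝ × ℝ :=
  (-2 * p.1 ^ 2 * (a + p.2.1 * p.1 * p.2.2 ^ 2 * expE p.2.1 ^ 2),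
   p.2.1 ^ 2 * (1 + b * p.1 * p.2.2 * (1 - 2 * expE p.2.1)),
   -p.2.2 * (-p.1 * (a + p.2.1 * p.1 * p.2.2 ^ 2 * expE p.2.1 ^ 2) +
      (1 + p.2.1) * (1 + b * p.1 * p.2.2 * (1 - 2 * expE p.2.1))))

theorem expE_eq_expNegInvGlue : expE = expNegInvGlue := by
  funext s
  by_cases hs : 0 < s
  · simp [expE, expNegInvGlue, hs, not_le.mpr hs, neg_div]
  · simp [expE, expNegInvGlue, hs, not_lt.mp hs]

theorem differentiable_expE : Differentiable ℝ expE := by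
  rw [expE_eq_expNegInvGlue]
  exact (expNegInvGlue.contDiff (n := 1)).differentiable one_ne_zero

/-- The linearization of `corbHatK31Field` at the origin. -/
theorem hasFDerivAt_corbHatK31Field_zero (a b : ℝ) :
    HasFDerivAt (corbHatK31Field a b)
      ((0 : ℝ →L[ℝ] ℝ).prodMap ((0 : ℝ →L[ℝ] ℝ).prodMap (-ContinuousLinearMap.id ℝ ℝ)))
      (0, 0, 0) := by
  have hE := differentiable_expE
  have hA : DifferentiableAt ℝ
      (fun p : ℝ × ℝ × ℝ => a + p.2.1 * p.1 * p.2.2 ^ 2 * expE p.2.1 ^ 2) (0, 0, 0) := by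
    fun_prop
  have hB : DifferentiableAt ℝ
      (fun p : ℝ × ℝ × ℝ => 1 + b * p.1 * p.2.2 * (1 - 2 * expE p.2.1)) (0, 0, 0) := by
    fun_prop
  have hx : HasFDerivAt (fun p : ℝ × ℝ × ℝ => p.1) (ContinuousLinearMap.fst ℝ ℝ (ℝ × ℝ)) (0, 0, 0) :=
    hasFDerivAt_fst
  have hyz : HasFDerivAt (fun p : ℝ × ℝ × ℝ => p.2) (ContinuousLinearMap.snd ℝ ℝ (ℝ × ℝ)) (0, 0, 0) :=
    hasFDerivAt_snd
  have hy := hyz.fst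
  have hz := hyz.snd
  have h₁ := ((hx.pow 2).const_mul (-2)).mul hA.hasFDerivAt
  have h₂ := (hy.pow 2).mul hB.hasFDerivAt
  have h₃ := hz.neg.mul ((hx.neg.mul hA.hasFDerivAt).add ((hy.const_add 1).mul hB.hasFDerivAt))
  refine (h₁.prodMk (h₂.prodMk h₃)).congr_fderiv ?_
  ext <;> simp

theorem LinearMap.charpoly_prodMap_zero_zero_neg_id :
    ((0 : ℝ →ₗ[ℝ] ℝ).prodMap ((0 : ℝ →ₗ[ℝ] ℝ).prodMap
        (-LinearMap.id : ℝ →ₗ[ℝ] ℝ))).charpoly =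
      Polynomial.X ^ 2 * (Polynomial.X + 1) := by
  have h : (-LinearMap.id : ℝ →ₗ[ℝ] ℝ).charpoly = Polynomial.X + 1 := by
    rw [← LinearMap.charpoly_toMatrix _ (Module.Basis.singleton Unit ℝ)]
    simp [Matrix.charpoly, Matrix.charmatrix, Module.Basis.toMatrix_apply]
  rw [LinearMap.charpoly_prodMap, LinearMap.charpoly_prodMap, h, LinearMap.charpoly_zero]
  simp
  ring

/-- The origin `p_s` is an equilibrium with eigenvalues `0, 0, −1` (characteristic
polynomial `λ²(λ + 1)`); the three coordinate axes are invariant with dynamics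
`r̂₁' = −2a·r̂₁²`, `σ' = σ²`, `ŝ₁' = −ŝ₁` respectively, so `p_s` is a non-hyperbolic
saddle whose strong stable manifold lies in `{r̂₁ = σ = 0}`. -/
theorem corbHatK31_saddle (a b : ℝ) (ha : 0 < a) (hb : b ∈ Set.Ioo (0 : ℝ) 1) :
    corbHatK31Field a b (0, 0, 0) = 0 ∧
    LinearMap.charpoly
        ((fderiv ℝ (corbHatK31Field a b) (0, 0, 0)).toLinearMap) =
      Polynomial.X ^ 2 * (Polynomial.X + 1) ∧
    (∀ r : ℝ, corbHatK31Field a b (r, 0, 0) = (-2 * a * r ^ 2, 0, 0)) ∧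
    (∀ σ : ℝ, corbHatK31Field a b (0, σ, 0) = (0, σ ^ 2, 0)) ∧
    (∀ s : ℝ, corbHatK31Field a b (0, 0, s) = (0, 0, -s)) ∧
    (∀ r : ℝ, 0 < r → -2 * a * r ^ 2 < 0) ∧
    (∀ σ : ℝ, 0 < σ → 0 < σ ^ 2) ∧
    (∀ s : ℝ, 0 < s → -s < 0) := by
  refine ⟨by simp [corbHatK31Field], ?_, fun r => ?_, fun σ => ?_, fun s => ?_, fun r hr => ?_,
    fun σ hσ => by positivity, fun s hs => neg_neg_of_pos hs⟩
  · rw [(hasFDerivAt_corbHatK31Field_zero a b).fderiv]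
    exact LinearMap.charpoly_prodMap_zero_zero_neg_id
  · simp [corbHatK31Field]
    ring
  · simp [corbHatK31Field]
  · simp [corbHatK31Field]
  · have : 0 < a * r ^ 2 := by positivity
    linarith
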